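/- arXiv:1712.09541 — 6 statements merged into one kernel-verified Lean document; each statement's English description precedes it below -/
import Mathlib

section
/- Let n ≥ 2 be an integer, let m be a real number with m > 1 − 2/n, let k ≥ 1 be an integer, and set p_k = 2^k + 1 and p_{k−1} = 2^{k−1} + 1. Define θ₂ := (1/p_k − (n−2)/(n(m+p_k−1))) / (1/p_{k−1} − (n−2)/(n(m+p_k−1))) and ℓ₂ := (m+p_k−1) / ((m+p_k−1) − (1−θ₂)·p_k). Then 1 < ℓ₂ < n + 1. -/
/-- the Hölder-conjugate exponent `ℓ₂` in the Moser iteration satisfies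
`1 < ℓ₂ < n + 1`. -/
theorem stmt_6 (n : ℕ) (hn : 2 ≤ n) (m : ℝ) (hm : m > 1 - 2 / (n : ℝ))
    (k : ℕ) (hk : 1 ≤ k) (pk pk1 : ℝ)
    (hpk : pk = 2 ^ k + 1) (hpk1 : pk1 = 2 ^ (k - 1) + 1)
    (θ₂ ℓ₂ : ℝ)
    (hθ₂ : θ₂ = (1 / pk - (n - 2) / (n * (m + pk - 1))) /
        (1 / pk1 - (n - 2) / (n * (m + pk - 1))))
    (hℓ₂ : ℓ₂ = (m + pk - 1) / ((m + pk - 1) - (1 - θ₂) * pk)) :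
    1 < ℓ₂ ∧ ℓ₂ < n + 1 := by
  obtain ⟨j, rfl⟩ : ∃ j, k = j + 1 := ⟨k - 1, by omega⟩
  have hn' : (2 : ℝ) ≤ n := by exact_mod_cast hn
  have hn0 : (0 : ℝ) < n := by linarith
  have hq : 2 ≤ pk1 := by
    have : (1 : ℝ) ≤ 2 ^ j := one_le_pow₀ (by norm_num)
    rw [hpk1, Nat.add_sub_cancel]
    linarith
  have hp : pk = 2 * pk1 - 1 := by
    rw [hpk, hpk1, Nat.add_sub_cancel, pow_succ]
    ring
  clear hpk hpk1
  have hnm : (n : ℝ) - 2 < n * m := by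
    have h := mul_lt_mul_of_pos_left hm hn0
    rwa [mul_sub, mul_one, mul_div_cancel₀ _ hn0.ne'] at h
  have hp0 : 0 < pk := by linarith
  obtain ⟨A, hA⟩ : ∃ A, A = m + pk - 1 := ⟨_, rfl⟩
  rw [← hA] at hθ₂ hℓ₂
  obtain ⟨D, hD⟩ : ∃ D, D = n * A - (n - 2) * pk1 := ⟨_, rfl⟩
  have hDlt : (pk1 - 1) * (n + 2) < D := by
    rw [hD, hA, hp]
    linarith
  have hq1 : 0 < (pk1 - 1) * n := mul_pos (by linarith) hn0
  have hD0 : 0 < D := by linarith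
  have hA0 : 0 < A := by
    have h : 0 < n * A := by
      have := mul_nonneg (sub_nonneg.2 hn') (by linarith : 0 ≤ pk1)
      linarith
    exact pos_of_mul_pos_right h hn0.le
  have hden : 1 / pk1 - (n - 2) / (n * A) = D / (n * A * pk1) := by
    rw [hD]
    field_simp
  have hθ : (1 - θ₂) * pk = (pk1 - 1) * n * A / D := by
    rw [hθ₂, hden]
    field_simp
    rw [hD, hp]
    ring
  have hE : 0 < D - (pk1 - 1) * n := by linarith
  have hℓ : ℓ₂ = D / (D - (pk1 - 1) * n) := by
    have : A - (pk1 - 1) * n * A / D = A * (D - (pk1 - 1) * n) / D := by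
      field_simp
    rw [hℓ₂, hθ, this]
    field_simp
  rw [hℓ, lt_div_iff₀ hE, div_lt_iff₀ hE]
  refine ⟨by linarith, ?_⟩
  have := mul_lt_mul_of_pos_left hDlt hn0
  linarith
end

section
/- Let n ≥ 2 be an integer, and let C̃ ≥ 1 and D ≥ 1 be real numbers. For each integer k ≥ 0 let y_k : [0, ∞) → [0, ∞) be a bounded function, set Y₀ := sup_{t ≥ 0} y₀(t), p_k := 2^k + 1, and a_k := C̃·2^{n+1}·2^{(n+1)k}. Assume that for every integer k ≥ 1 and every t ≥ 0, y_k(t) ≤ 2·a_k·max{ (sup_{s ≥ 0} y_{k−1}(s))², D^{2^k} }. Then for every integer k ≥ 1 and every t ≥ 0, y_k(t)^{1/p_k} ≤ 2^{n+2}·2^{2(n+1)}·C̃·max{ Y₀, D }. -/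
/-- If `N (k + 1) ≤ K * q ^ (k + 1) * N k ^ 2` for all `k`, then `N k` grows at most like the
`2 ^ k`-th power of `K * q ^ 2 * m`, where `m` bounds `N 0`. -/
theorem mul_pow_le_of_quadratic_recursion {K q m : ℝ} (hK : 0 ≤ K) (hq : 0 ≤ q) {N : ℕ → ℝ}
    (hN : ∀ k, 0 ≤ N k) (h_zero : N 0 ≤ m)
    (h_succ : ∀ k, N (k + 1) ≤ K * q ^ (k + 1) * N k ^ 2) (k : ℕ) :
    N k * (K * q ^ (k + 2)) ≤ (K * q ^ 2 * m) ^ 2 ^ k := by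
  induction k with
  | zero =>
    have := mul_le_mul_of_nonneg_left h_zero (by positivity : 0 ≤ K * q ^ 2)
    simpa [mul_comm] using this
  | succ k ih =>
    have hNk := hN k
    calc N (k + 1) * (K * q ^ (k + 1 + 2))
        ≤ K * q ^ (k + 1) * N k ^ 2 * (K * q ^ (k + 1 + 2)) := by
          gcongr
          exact h_succ k
      _ = (N k * (K * q ^ (k + 2))) ^ 2 := by ring
      _ ≤ ((K * q ^ 2 * m) ^ 2 ^ k) ^ 2 := by gcongr
      _ = (K * q ^ 2 * m) ^ 2 ^ (k + 1) := by rw [← pow_mul, pow_succ 2 k]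


/-- final step of the Moser iteration: under the recursive bound,
`y_k(t)^{1/p_k} ≤ 2^{n+2} 2^{2(n+1)} C̃ max{Y₀, D}` uniformly in `k ≥ 1` and `t ≥ 0`,
where `p_k = 2^k + 1`. -/
theorem stmt_11 (n : ℕ) (hn : 2 ≤ n) (C D : ℝ) (hC : 1 ≤ C) (hD : 1 ≤ D)
    (y : ℕ → ℝ → ℝ)
    (hnonneg : ∀ k, ∀ t ∈ Set.Ici (0 : ℝ), 0 ≤ y k t)
    (hbdd : ∀ k, BddAbove (y k '' Set.Ici 0))
    (Y₀ : ℝ) (hY₀ : Y₀ = sSup (y 0 '' Set.Ici 0))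
    (p : ℕ → ℝ) (hp : ∀ k, p k = 2 ^ k + 1)
    (a : ℕ → ℝ) (ha : ∀ k, a k = C * 2 ^ (n + 1) * 2 ^ ((n + 1) * k))
    (hrec : ∀ k : ℕ, 1 ≤ k → ∀ t ∈ Set.Ici (0 : ℝ),
      y k t ≤ 2 * a k * max ((sSup (y (k - 1) '' Set.Ici 0)) ^ 2) (D ^ (2 ^ k))) :
    ∀ k : ℕ, 1 ≤ k → ∀ t ∈ Set.Ici (0 : ℝ),
      (y k t) ^ (1 / p k) ≤ (2 : ℝ) ^ (n + 2) * (2 : ℝ) ^ (2 * (n + 1)) * C * max Y₀ D := by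
  have h_nonempty (k : ℕ) : (y k '' Set.Ici 0).Nonempty := Set.nonempty_Ici.image _
  have h_le_sup (k : ℕ) (t : ℝ) (ht : t ∈ Set.Ici (0 : ℝ)) : y k t ≤ sSup (y k '' Set.Ici 0) :=
    le_csSup (hbdd k) (Set.mem_image_of_mem _ ht)
  have h_sup_nonneg (k : ℕ) : 0 ≤ sSup (y k '' Set.Ici 0) :=
    (hnonneg k 0 Set.self_mem_Ici).trans (h_le_sup k 0 Set.self_mem_Ici)
  set K : ℝ := 2 ^ (n + 2) * C with hK
  set q : ℝ := 2 ^ (n + 1) with hq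
  have hq_one : 1 ≤ q := one_le_pow₀ one_le_two
  have hK_one : 1 ≤ K := one_le_mul_of_one_le_of_one_le (one_le_pow₀ one_le_two) hC
  have hm_one : 1 ≤ max Y₀ D := hD.trans (le_max_right _ _)
  have h_succ (k : ℕ) : max (sSup (y (k + 1) '' Set.Ici 0)) (D ^ 2 ^ (k + 1)) ≤
      K * q ^ (k + 1) * max (sSup (y k '' Set.Ici 0)) (D ^ 2 ^ k) ^ 2 := by
    have h_max : max (sSup (y k '' Set.Ici 0) ^ 2) (D ^ 2 ^ (k + 1)) ≤
        max (sSup (y k '' Set.Ici 0)) (D ^ 2 ^ k) ^ 2 := by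
      rw [pow_succ 2 k, pow_mul]
      exact max_le (pow_le_pow_left₀ (h_sup_nonneg k) (le_max_left _ _) 2)
        (pow_le_pow_left₀ (by positivity) (le_max_right _ _) 2)
    refine max_le (csSup_le (h_nonempty _) ?_) ?_
    · rintro _ ⟨t, ht, rfl⟩
      have h_coeff : 2 * a (k + 1) = K * q ^ (k + 1) := by
        rw [ha, hK, hq, pow_mul]
        ring
      refine (hrec (k + 1) k.succ_pos t ht).trans ?_
      rw [h_coeff, Nat.add_sub_cancel]
      gcongr
    · exact ((le_max_right _ _).trans h_max).trans (le_mul_of_one_le_left (sq_nonneg _)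
        (one_le_mul_of_one_le_of_one_le hK_one (one_le_pow₀ hq_one)))
  have h_zero : max (sSup (y 0 '' Set.Ici 0)) (D ^ 2 ^ 0) ≤ max Y₀ D := by simp [hY₀]
  intro k _ t ht
  have h_growth := mul_pow_le_of_quadratic_recursion (by positivity : 0 ≤ K)
    (by positivity : 0 ≤ q) (fun k => (h_sup_nonneg k).trans (le_max_left _ (D ^ 2 ^ k)))
    h_zero h_succ k
  have hB : (2 : ℝ) ^ (n + 2) * 2 ^ (2 * (n + 1)) * C * max Y₀ D = K * q ^ 2 * max Y₀ D := by
    rw [hK, hq]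
    ring
  have hB_one : 1 ≤ K * q ^ 2 * max Y₀ D :=
    one_le_mul_of_one_le_of_one_le
      (one_le_mul_of_one_le_of_one_le hK_one (one_le_pow₀ hq_one)) hm_one
  have h_pow : y k t ≤ (K * q ^ 2 * max Y₀ D) ^ (2 ^ k + 1) :=
    calc y k t ≤ max (sSup (y k '' Set.Ici 0)) (D ^ 2 ^ k) :=
          (h_le_sup k t ht).trans (le_max_left _ _)
      _ ≤ max (sSup (y k '' Set.Ici 0)) (D ^ 2 ^ k) * (K * q ^ (k + 2)) :=
          le_mul_of_one_le_right ((h_sup_nonneg k).trans (le_max_left _ _))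
            (one_le_mul_of_one_le_of_one_le hK_one (one_le_pow₀ hq_one))
      _ ≤ (K * q ^ 2 * max Y₀ D) ^ 2 ^ k := h_growth
      _ ≤ (K * q ^ 2 * max Y₀ D) ^ (2 ^ k + 1) := pow_le_pow_right₀ hB_one (Nat.le_succ _)
  have hp_cast : p k = ((2 ^ k + 1 : ℕ) : ℝ) := by
    rw [hp]
    push_cast
    rfl
  rw [hB, hp_cast, one_div, Real.rpow_inv_le_iff_of_pos (hnonneg k t ht)
    (zero_le_one.trans hB_one) (by positivity), Real.rpow_natCast]
  exact h_pow
end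

section
/- Let n ≥ 2 be an integer and let A, m, p be real numbers with 2 − n < A < 2, m > 1 − A/n, p > 1 and p > (A−2+n)/(2−A). Set θ := ((2−A)(p+1) − n)/(np) and θ₁ := (n(m+p−1) − (p+1)(n−2)) / ((p+1)(n(m+p−1) − (n−2))). Then n(m+p−1) − (n−2) > 0 and (1−θ₁)(p+θ)/(m+p−1) < 1. -/
/-- in the diffusion-dominated regime, `n(m+p-1)-(n-2) > 0` and
`(1-θ₁)(p+θ)/(m+p-1) < 1`. -/
theorem stmt_14 (n : ℕ) (hn : 2 ≤ n) (A m p : ℝ)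
    (hA1 : 2 - (n : ℝ) < A) (hA2 : A < 2)
    (hm : m > 1 - A / n) (hp1 : 1 < p) (hp2 : (A - 2 + n) / (2 - A) < p)
    (θ θ₁ : ℝ)
    (hθ : θ = ((2 - A) * (p + 1) - n) / (n * p))
    (hθ₁ : θ₁ = (n * (m + p - 1) - (p + 1) * (n - 2)) /
        ((p + 1) * (n * (m + p - 1) - (n - 2)))) :
    n * (m + p - 1) - (n - 2) > 0 ∧ (1 - θ₁) * (p + θ) / (m + p - 1) < 1 := by
  have hn2 : (2 : ℝ) ≤ n := by exact_mod_cast hn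
  have hn0 : (0 : ℝ) < n := by linarith
  have hm' : n * (m + p - 1) > n * p - A := by
    have h := mul_lt_mul_of_pos_left hm hn0
    have h' : (n : ℝ) * (1 - A / n) = n - A := by field_simp
    linarith
  have hnum : (0 : ℝ) < n * (p - 1) := mul_pos hn0 (by linarith)
  have hs : 0 < m + p - 1 := pos_of_mul_pos_right (by linarith) hn0.le
  have hD : n * (m + p - 1) - (n - 2) > 0 := by linarith
  refine ⟨hD, ?_⟩
  have hp0 : 0 < p := by linarith
  have hp1' : p + 1 ≠ 0 := by linarith
  have h1 : 1 - θ₁ = p * n * (m + p - 1) / ((p + 1) * (n * (m + p - 1) - (n - 2))) := by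
    rw [hθ₁, eq_div_iff (mul_ne_zero hp1' hD.ne'), sub_mul,
      div_mul_cancel₀ _ (mul_ne_zero hp1' hD.ne')]
    ring
  have h2 : p + θ = (p + 1) * (n * (p - 1) + 2 - A) / (n * p) := by
    rw [hθ]
    field_simp
    ring
  have h3 : (1 - θ₁) * (p + θ) / (m + p - 1) =
      (n * (p - 1) + 2 - A) / (n * (m + p - 1) - (n - 2)) := by
    rw [h1, h2]
    generalize n * (m + p - 1) - ((n : ℝ) - 2) = D at hD
    generalize m + p - 1 = s at hs
    have := hD.ne'
    field_simp
  rw [h3, div_lt_one hD]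
  linarith
end

section
/- Let n ≥ 2 be an integer and let A be a real number with 2 − n < A < 2. For real numbers r, s > 1 define C̄(n,A,r,s) := (n/(n−2+A))·(ω_{n−1}/n)^{(2−A)/n}·(1/(sr))·[ ((2−A)/(n(1−1/s)))^{(2−A)/n} + ((2−A)/(n(1−1/r)))^{(2−A)/n} ], where ω_{n−1} := n·αₙ and αₙ is the Lebesgue volume of the unit ball of ℝⁿ. Then there exists a constant C > 0, depending only on n and A, such that for every real p ≥ 1 + n/(2−A) + n, taking r = (p+1)/p and s = n(p+1)/((n−2+A)(p+1)+n), one has C̄(n,A,r,s) ≤ C·(p+1). -/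
open MeasureTheory

/-- along the iteration exponents, the explicit Lieb–Loss bound
`C̄(n,A,r,s)` for the HLS constant grows at most linearly in `p`. -/
theorem stmt_15 (n : ℕ) (hn : 2 ≤ n) (A : ℝ) (hA1 : 2 - (n : ℝ) < A) (hA2 : A < 2)
    (α ω : ℝ)
    (hα : α = (volume (Metric.ball (0 : EuclideanSpace ℝ (Fin n)) 1)).toReal)
    (hω : ω = n * α)
    (Cbar : ℝ → ℝ → ℝ)
    (hCbar : ∀ r s : ℝ, Cbar r s =
      ((n : ℝ) / (n - 2 + A)) * (ω / n) ^ ((2 - A) / n) * (1 / (s * r)) *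
        (((2 - A) / (n * (1 - 1 / s))) ^ ((2 - A) / n)
          + ((2 - A) / (n * (1 - 1 / r))) ^ ((2 - A) / n))) :
    ∃ C : ℝ, 0 < C ∧ ∀ p : ℝ, p ≥ 1 + n / (2 - A) + n →
      Cbar ((p + 1) / p) (n * (p + 1) / ((n - 2 + A) * (p + 1) + n)) ≤ C * (p + 1) := by
  have hn0 : (0 : ℝ) < n := by positivity
  have hα0 : 0 ≤ α := hα ▸ ENNReal.toReal_nonneg
  have ha : 0 < 2 - A := by linarith
  have han : 2 - A < n := by linarith
  have hω0 : 0 ≤ ω / n := by rw [hω]; positivity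
  have hna : 0 < (n : ℝ) - 2 + A := by linarith
  obtain ⟨K, hK⟩ : ∃ K, K = ((n : ℝ) / (n - 2 + A)) * (ω / n) ^ ((2 - A) / n) := ⟨_, rfl⟩
  have hK0 : 0 ≤ K := by rw [hK]; positivity
  refine ⟨4 * K + 1, by positivity, fun p hp => ?_⟩
  have hp0 : 0 < (n : ℝ) / (2 - A) := by positivity
  have hp1 : 0 < p := by linarith
  have hq1 : 1 ≤ p + 1 := by linarith
  have hq0 : 0 < p + 1 := by linarith
  have haq : 2 - A ≤ (2 - A) * (p + 1) - n := by
    have h : (2 - A) * (1 + n / (2 - A) + n) ≤ (2 - A) * p := by gcongr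
    have e : (2 - A) * (1 + n / (2 - A) + n) = (2 - A) + n + (2 - A) * n := by field_simp
    nlinarith [mul_pos ha hn0]
  have hs : 1 / (n * (p + 1) / ((n - 2 + A) * (p + 1) + n))
      = 1 - ((2 - A) * (p + 1) - n) / (n * (p + 1)) := by
    field_simp
    ring
  have hr : 1 / ((p + 1) / p) = 1 - 1 / (p + 1) := by
    field_simp
    ring
  have hfac : 1 / (n * (p + 1) / ((n - 2 + A) * (p + 1) + n) * ((p + 1) / p)) ≤ 2 := by
    rw [← one_div_mul_one_div, hs, hr]
    have h1 : 0 ≤ ((2 - A) * (p + 1) - n) / (n * (p + 1)) := div_nonneg (by linarith) (by positivity)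
    have h2 : 0 ≤ 1 / (p + 1) := by positivity
    have h3 : 1 / (p + 1) ≤ 1 := (div_le_one hq0).2 hq1
    nlinarith [mul_nonneg h1 (sub_nonneg.2 h3)]
  have hθ : ∀ x : ℝ, 0 ≤ x → x ≤ p + 1 → x ^ ((2 - A) / n) ≤ p + 1 := fun x hx hxp =>
    calc x ^ ((2 - A) / n) ≤ (p + 1) ^ ((2 - A) / n) := Real.rpow_le_rpow hx hxp (by positivity)
      _ ≤ (p + 1) ^ (1 : ℝ) :=
        Real.rpow_le_rpow_of_exponent_le hq1 ((div_le_one hn0).2 han.le)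
      _ = p + 1 := Real.rpow_one _
  have hb1 : (2 - A) / (n * (1 - 1 / (n * (p + 1) / ((n - 2 + A) * (p + 1) + n))))
      = (2 - A) * (p + 1) / ((2 - A) * (p + 1) - n) := by
    have : (2 - A) * (p + 1) - n ≠ 0 := by linarith
    rw [hs, sub_sub_cancel]
    field_simp
  have hb2 : (2 - A) / (n * (1 - 1 / ((p + 1) / p))) = (2 - A) * (p + 1) / n := by
    rw [hr, sub_sub_cancel]
    field_simp
  have h1 := hθ ((2 - A) * (p + 1) / ((2 - A) * (p + 1) - n))
    (div_nonneg (by positivity) (by linarith))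
    ((div_le_iff₀ (by linarith)).2 (by nlinarith))
  have h2 := hθ ((2 - A) * (p + 1) / n) (by positivity)
    ((div_le_iff₀ hn0).2 (by nlinarith))
  rw [hCbar, ← hK, hb1, hb2]
  calc _ ≤ K * 2 * ((p + 1) + (p + 1)) := by
        gcongr
        exact add_nonneg (Real.rpow_nonneg (div_nonneg (by positivity) (by linarith)) _)
          (by positivity)
    _ ≤ (4 * K + 1) * (p + 1) := by linarith
end

section
/- Let n ≥ 2 be an integer and let A, m be real numbers with 2 − n < A < 2 and m > 1 − A/n. Let k ≥ 1 be an integer and set p_k = 2^k + n/(2−A) + n and p_{k−1} = 2^{k−1} + n/(2−A) + n. Define θ := ((2−A)(p_k+1) − n)/(n·p_k), θ₁ := (1/(p_k+1) − (n−2)/(n(m+p_k−1))) / (1/p_{k−1} − (n−2)/(n(m+p_k−1))), and ν₂ := (m+p_k−1) / ((m+p_k−1) − (1−θ₁)(p_k+θ)). Then 1 < ν₂ < n + 1. -/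
/-- in the purely attractive case the Hölder-conjugate exponent `ν₂`
satisfies `1 < ν₂ < n + 1`. -/
theorem stmt_17 (n : ℕ) (hn : 2 ≤ n) (A m : ℝ)
    (hA1 : 2 - (n : ℝ) < A) (hA2 : A < 2) (hm : m > 1 - A / n)
    (k : ℕ) (hk : 1 ≤ k) (pk pk1 : ℝ)
    (hpk : pk = 2 ^ k + n / (2 - A) + n) (hpk1 : pk1 = 2 ^ (k - 1) + n / (2 - A) + n)
    (θ θ₁ ν₂ : ℝ)
    (hθ : θ = ((2 - A) * (pk + 1) - n) / (n * pk))
    (hθ₁ : θ₁ = (1 / (pk + 1) - (n - 2) / (n * (m + pk - 1))) /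
        (1 / pk1 - (n - 2) / (n * (m + pk - 1))))
    (hν₂ : ν₂ = (m + pk - 1) / ((m + pk - 1) - (1 - θ₁) * (pk + θ))) :
    1 < ν₂ ∧ ν₂ < n + 1 := by
  have hN : (2 : ℝ) ≤ n := by exact_mod_cast hn
  have hn0 : (0 : ℝ) < n := by linarith
  obtain ⟨d, rfl⟩ : ∃ d, A = 2 - d := ⟨2 - A, by ring⟩
  have hd : 0 < d := by linarith
  have hdn : d < n := by linarith
  simp only [sub_sub_cancel] at hpk hpk1 hθ
  obtain ⟨t, ht⟩ : ∃ t : ℝ, t = 2 ^ (k - 1) := ⟨_, rfl⟩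
  have ht1 : 1 ≤ t := ht ▸ one_le_pow₀ (by norm_num)
  have h2k : (2 : ℝ) ^ k = 2 * t := by
    rw [ht, ← pow_succ', Nat.sub_add_cancel hk]
  rw [h2k] at hpk
  rw [← ht] at hpk1
  have hr : 1 < n / d := (one_lt_div hd).mpr hdn
  have hp : 0 < pk := by linarith
  have hq : 0 < pk1 := by linarith
  have hpq : pk = pk1 + t := by linarith
  obtain ⟨M, hM⟩ : ∃ M, M = m + pk - 1 := ⟨_, rfl⟩
  rw [← hM] at hθ₁ hν₂
  have hnM : n * pk - 2 + d < n * M := by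
    have h : n * (1 - (2 - d) / n) < n * m := mul_lt_mul_of_pos_left hm hn0
    have h' : n * (1 - (2 - d) / n) = n - 2 + d := by field_simp; ring
    rw [hM]
    linarith
  have hM0 : 0 < M := by
    refine pos_of_mul_pos_right ?_ hn0.le
    nlinarith
  obtain ⟨D, hD⟩ : ∃ D, D = n * M - (n - 2) * pk1 := ⟨_, rfl⟩
  have hDlow : (n + 1) * (t + 1) < D := by
    rw [hD]
    have : (n : ℝ) * pk = n * pk1 + n * t := by rw [hpq]; ring
    linarith
  have hD0 : 0 < D := lt_trans (by positivity) hDlow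
  obtain ⟨E, hE⟩ : ∃ E, E = (t + 1) * (n * (pk - 1) + d) := ⟨_, rfl⟩
  have hE0 : 0 < E := by
    rw [hE]
    have : 0 < n * (pk - 1) := mul_pos hn0 (by linarith)
    positivity
  have hED : (n + 1) * E < n * (pk * D) := by
    have h1 : n * (pk - 1) + d < n * pk := by linarith
    calc (n + 1) * E = ((n + 1) * (t + 1)) * (n * (pk - 1) + d) := by rw [hE]; ring
      _ < ((n + 1) * (t + 1)) * (n * pk) := by gcongr
      _ < D * (n * pk) := by gcongr
      _ = n * (pk * D) := by ring
  have hθ' : pk + θ = (pk + 1) * (n * (pk - 1) + d) / (n * pk) := by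
    rw [hθ]; field_simp; ring
  have hden : 1 / pk1 - (n - 2) / (n * M) = D / (pk1 * (n * M)) := by
    rw [hD]; field_simp
  have hθ₁' : 1 - θ₁ = (t + 1) * (n * M) / ((pk + 1) * D) := by
    have h1 : 1 / pk1 - (n - 2) / (n * M) ≠ 0 := by rw [hden]; positivity
    rw [hθ₁, one_sub_div h1, sub_sub_sub_cancel_right, hden, hpq]
    have : pk1 + t + 1 ≠ 0 := by positivity
    field_simp
    ring
  have hν : ν₂ = pk * D / (pk * D - E) := by
    have h : M - (1 - θ₁) * (pk + θ) = M * ((pk * D - E) / (pk * D)) := by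
      rw [hθ', hθ₁', hE]; field_simp
    rw [hν₂, h, div_mul_cancel_left₀ hM0.ne', inv_div]
  have hpDE : 0 < pk * D - E := by
    nlinarith
  rw [hν]
  exact ⟨by rw [one_lt_div hpDE]; linarith, by rw [div_lt_iff₀ hpDE]; linarith⟩
end

section
/- Let n ≥ 3 be an integer and let m, p be real numbers with m > 1 − 2/n and p > 1. Set θ₁ := 1 − (p−1)(m+p−1)n / (p((m+p−1)n − n + 2)). Then there exists a constant C > 0, depending only on n, m, p, such that for every nonnegative continuously differentiable function u : ℝⁿ → ℝ with compact support, setting ρ := u^{2/(m+p−1)}, one has ∫_{ℝⁿ} ρ^p dx ≤ C · (∫_{ℝⁿ} ρ dx)^{pθ₁} · (∫_{ℝⁿ} ‖∇u(x)‖² dx)^{p(1−θ₁)/(m+p−1)}. -/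
open MeasureTheory

/-- Hölder interpolation of the `L^p` norm between `L^1` and `L^q`, with real-valued integrals. -/
theorem integral_rpow_le_mul_integral_rpow {E : Type*} [TopologicalSpace E]
    [MeasurableSpace E] [OpensMeasurableSpace E] {μ : Measure E}
    [IsFiniteMeasureOnCompacts μ] {f : E → ℝ} (hf : Continuous f) (h2f : HasCompactSupport f)
    (h0f : ∀ x, 0 ≤ f x) {a b q : ℝ} (ha : 0 < a) (hb : 0 < b) (hab : a + b = 1) (hq : 0 < q) :
    ∫ x, f x ^ (a + q * b) ∂μ ≤ (∫ x, f x ∂μ) ^ a * (∫ x, f x ^ q ∂μ) ^ b := by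
  have hconj : Real.HolderConjugate a⁻¹ b⁻¹ :=
    Real.holderConjugate_iff.2 ⟨(one_lt_inv₀ ha).2 (by linarith), by simpa using hab⟩
  have hmem (s : ℝ) (hs : 0 < s) (t : ENNReal) : MemLp (fun x ↦ f x ^ s) t μ :=
    (hf.rpow_const fun _ ↦ Or.inr hs.le).memLp_of_hasCompactSupport
      (h2f.comp_left (g := fun y : ℝ ↦ y ^ s) (Real.zero_rpow hs.ne'))
  have h := integral_mul_le_Lp_mul_Lq_of_nonneg hconj
    (ae_of_all μ fun x ↦ Real.rpow_nonneg (h0f x) a)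
    (ae_of_all μ fun x ↦ Real.rpow_nonneg (h0f x) (q * b))
    (hmem a ha _) (hmem (q * b) (by positivity) _)
  convert h using 1
  · congr! 2 with x
    exact Real.rpow_add_of_nonneg (h0f x) ha.le (by positivity)
  · simp only [one_div, inv_inv]
    congr! 4 with x x
    · rw [← Real.rpow_mul (h0f x), mul_inv_cancel₀ ha.ne', Real.rpow_one]
    · rw [← Real.rpow_mul (h0f x), mul_assoc, mul_inv_cancel₀ hb.ne', mul_one]

/-- The Sobolev inequality for `C¹` compactly supported functions on `ℝⁿ`, `n ≥ 3`, with
real-valued integrals. -/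
theorem exists_integral_rpow_le_integral_norm_gradient_sq (n : ℕ) (hn : 3 ≤ n) :
    ∃ C : ℝ, 0 < C ∧ ∀ u : EuclideanSpace ℝ (Fin n) → ℝ,
      ContDiff ℝ 1 u → HasCompactSupport u → (∀ x, 0 ≤ u x) →
      ∫ x, u x ^ (2 * n / (n - 2) : ℝ)
        ≤ C * (∫ x, ‖gradient u x‖ ^ 2) ^ (n / (n - 2) : ℝ) := by
  have hn' : (3 : ℝ) ≤ n := by exact_mod_cast hn
  have hn2 : (0 : ℝ) < n - 2 := by linarith
  set r : ℝ := 2 * n / (n - 2) with hr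
  have hr0 : 0 < r := by positivity
  let K : NNReal := eLpNormLESNormFDerivOfEqInnerConst
    (volume : Measure (EuclideanSpace ℝ (Fin n))) ((2 : NNReal) : ℝ)
  refine ⟨((K : ℝ) + 1) ^ r, by positivity, fun u hu h2u h0u ↦ ?_⟩
  have hS : eLpNorm u (Real.toNNReal r) volume ≤
      K * eLpNorm (fderiv ℝ u) (2 : NNReal) volume := by
    refine eLpNorm_le_eLpNorm_fderiv_of_eq_inner volume hu h2u (by norm_num)
      (by simp; omega) ?_
    rw [Real.coe_toNNReal _ hr0.le, hr, finrank_euclideanSpace_fin]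
    push_cast
    field_simp
  rw [(hu.continuous.memLp_of_hasCompactSupport h2u).eLpNorm_eq_integral_rpow_norm
      (by simpa using hr0) (by simp),
    ((hu.continuous_fderiv one_ne_zero).memLp_of_hasCompactSupport
      (h2u.fderiv ℝ)).eLpNorm_eq_integral_rpow_norm (by simp) (by simp),
    ← ENNReal.ofReal_coe_nnreal (p := K), ← ENNReal.ofReal_mul K.coe_nonneg,
    ENNReal.ofReal_le_ofReal_iff (by positivity)] at hS
  simp only [ENNReal.coe_toReal, Real.coe_toNNReal _ hr0.le, NNReal.coe_ofNat,
    Real.rpow_ofNat, Real.norm_of_nonneg (h0u _)] at hS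
  have hgrad (x) : ‖gradient u x‖ = ‖fderiv ℝ u x‖ := LinearIsometryEquiv.norm_map _ _
  simp only [hgrad]
  have hI : 0 ≤ ∫ x, u x ^ r := integral_nonneg fun x ↦ Real.rpow_nonneg (h0u x) r
  have hD : 0 ≤ ∫ x, ‖fderiv ℝ u x‖ ^ 2 := integral_nonneg fun x ↦ by positivity
  calc ∫ x, u x ^ r = ((∫ x, u x ^ r) ^ r⁻¹) ^ r := (Real.rpow_inv_rpow hI hr0.ne').symm
    _ ≤ (((K : ℝ) + 1) * (∫ x, ‖fderiv ℝ u x‖ ^ 2) ^ (2 : ℝ)⁻¹) ^ r := by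
      gcongr
      exact hS.trans (by gcongr; linarith)
    _ = ((K : ℝ) + 1) ^ r * (∫ x, ‖fderiv ℝ u x‖ ^ 2) ^ (n / (n - 2) : ℝ) := by
      rw [Real.mul_rpow (by positivity) (by positivity), ← Real.rpow_mul hD]
      congr 2
      rw [hr]
      ring

/-- combined interpolation–Sobolev estimate
`‖ρ‖_{L^p}^p ≤ C ‖ρ‖_{L^1}^{pθ₁} ‖∇ρ^{(m+p-1)/2}‖_{L²}^{2p(1-θ₁)/(m+p-1)}`
for `ρ = u^{2/(m+p-1)}` with `u` nonnegative, `C¹`, compactly supported. -/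
theorem stmt_18 (n : ℕ) (hn : 3 ≤ n) (m p : ℝ)
    (hm : m > 1 - 2 / (n : ℝ)) (hp : 1 < p)
    (θ₁ : ℝ)
    (hθ₁ : θ₁ = 1 - (p - 1) * (m + p - 1) * n / (p * ((m + p - 1) * n - n + 2))) :
    ∃ C : ℝ, 0 < C ∧ ∀ u : EuclideanSpace ℝ (Fin n) → ℝ,
      ContDiff ℝ 1 u → HasCompactSupport u → (∀ x, 0 ≤ u x) →
      (∫ x, (u x ^ (2 / (m + p - 1))) ^ p)
        ≤ C * (∫ x, u x ^ (2 / (m + p - 1))) ^ (p * θ₁) *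
            (∫ x, ‖gradient u x‖ ^ 2) ^ (p * (1 - θ₁) / (m + p - 1)) := by
  have hn' : (3 : ℝ) ≤ n := by exact_mod_cast hn
  have hn2 : (0 : ℝ) < n - 2 := by linarith
  have hmn : (n : ℝ) - 2 < m * n := by
    have h := mul_lt_mul_of_pos_right hm (by linarith : (0 : ℝ) < n)
    rwa [sub_mul, one_mul, div_mul_cancel₀ _ (by linarith)] at h
  set k : ℝ := m + p - 1 with hk
  have hk0 : 0 < k := by
    have : 0 < m := by
      by_contra! h
      nlinarith
    linarith
  have hpq : p * (n - 2) < k * n := by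
    rw [hk]
    nlinarith
  have hd : 0 < k * n - n + 2 := by nlinarith
  set q : ℝ := k * n / (n - 2) with hq
  have hq0 : 0 < q := by positivity
  have hθ : 1 - θ₁ = (p - 1) * k * n / (p * (k * n - n + 2)) := by
    rw [hθ₁]
    ring
  set b : ℝ := p * (1 - θ₁) / q with hb
  have hb' : b = (p - 1) * (n - 2) / (k * n - n + 2) := by
    rw [hb, hθ, hq]
    field_simp
  have hb0 : 0 < b := by
    rw [hb']
    have : 0 < p - 1 := by linarith
    positivity
  have hqb : q * b = p * (1 - θ₁) := by
    rw [hb]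
    field_simp
  have hab : p * θ₁ + b = 1 := by
    have hq1 : q - 1 = (k * n - n + 2) / (n - 2) := by
      rw [hq]
      field_simp
      ring
    have hqb1 : (q - 1) * b = p - 1 := by
      rw [hq1, hb', div_mul_div_comm, mul_left_comm, mul_comm (k * n - n + 2), ← mul_assoc,
        mul_div_mul_right _ _ hd.ne', mul_div_cancel_right₀ _ hn2.ne']
    linarith
  have ha0 : 0 < p * θ₁ := by
    have : b < 1 := by
      rw [hb', div_lt_one hd]
      nlinarith
    linarith
  obtain ⟨C, hC, hS⟩ := exists_integral_rpow_le_integral_norm_gradient_sq n hn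
  refine ⟨C ^ b, by positivity, fun u hu h2u h0u ↦ ?_⟩
  have hk2 : 0 < 2 / k := by positivity
  have h0ρ (x) : 0 ≤ u x ^ (2 / k) := Real.rpow_nonneg (h0u x) _
  have hD : 0 ≤ ∫ x, ‖gradient u x‖ ^ 2 := integral_nonneg fun x ↦ by positivity
  have hρq : ∫ x, (u x ^ (2 / k)) ^ q = ∫ x, u x ^ (2 * n / (n - 2) : ℝ) := by
    congr! 2 with x
    rw [← Real.rpow_mul (h0u x), hq]
    congr 1
    field_simp
  calc ∫ x, (u x ^ (2 / k)) ^ p = ∫ x, (u x ^ (2 / k)) ^ (p * θ₁ + q * b) := by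
        rw [hqb]
        ring_nf
    _ ≤ (∫ x, u x ^ (2 / k)) ^ (p * θ₁) * (∫ x, (u x ^ (2 / k)) ^ q) ^ b :=
      integral_rpow_le_mul_integral_rpow
        (hu.continuous.rpow_const fun _ ↦ Or.inr hk2.le)
        (h2u.comp_left (g := fun y : ℝ ↦ y ^ (2 / k)) (Real.zero_rpow hk2.ne'))
        h0ρ ha0 hb0 hab hq0
    _ ≤ (∫ x, u x ^ (2 / k)) ^ (p * θ₁) *
        (C * (∫ x, ‖gradient u x‖ ^ 2) ^ (n / (n - 2) : ℝ)) ^ b := by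
      have h0 : 0 ≤ ∫ x, u x ^ (2 / k) := integral_nonneg h0ρ
      have h1 : 0 ≤ ∫ x, (u x ^ (2 / k)) ^ q :=
        integral_nonneg fun x ↦ Real.rpow_nonneg (h0ρ x) q
      gcongr
      exact hρq.trans_le (hS u hu h2u h0u)
    _ = C ^ b * (∫ x, u x ^ (2 / k)) ^ (p * θ₁) *
        (∫ x, ‖gradient u x‖ ^ 2) ^ (p * (1 - θ₁) / k) := by
      rw [Real.mul_rpow hC.le (by positivity), ← Real.rpow_mul hD,
        show n / (n - 2) * b = p * (1 - θ₁) / k by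
          rw [hb, hq]
          field_simp]
      ring
end
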